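/- Let n ≥ 1 and 0 < s < 1 with n > 2s, and let R, M > 0. Let h : ℝⁿ×ℝ → ℝ be measurable with 0 ≤ h ≤ M and h(y,τ) = 0 whenever |y| > R or |τ| > R². Define v(x,t) = ∫_ℝ ∫_{ℝⁿ} G(x−y, t−τ) h(y,τ) dy dτ. Then v(x,t) → 0 as |t| → ∞ uniformly in x; that is, for every ε > 0 there exists K > 0 such that v(x,t) ≤ ε for all x ∈ ℝⁿ whenever |t| ≥ K. -/

import Mathlib

open MeasureTheory

/-- `ℝⁿ` as Euclidean space. -/
abbrev En (n : ℕ) := EuclideanSpace ℝ (Fin n)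

/-- The fundamental solution `G(x,t) = A_{n,s} t^{-(n/2+1-s)} e^{-|x|²/(4t)}` for `t > 0`,
`G(x,t) = 0` for `t ≤ 0`, with `A_{n,s} = (4π)^{-n/2}/Γ(s)`. -/
noncomputable def Gker (n : ℕ) (s : ℝ) (x : En n) (t : ℝ) : ℝ :=
  if 0 < t then
    ((4 * Real.pi) ^ (-(n : ℝ) / 2) / Real.Gamma s) *
      (t ^ (-((n : ℝ) / 2 + 1 - s)) * Real.exp (-‖x‖ ^ 2 / (4 * t)))
  else 0

theorem Gker_nonneg {n : ℕ} {s : ℝ} (hs : 0 < s) (x : En n) (t : ℝ) : 0 ≤ Gker n s x t := by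
  have hΓ := Real.Gamma_pos_of_pos hs
  unfold Gker
  split_ifs with ht <;> positivity

/-- Away from the initial time the kernel is bounded uniformly in space. -/
theorem Gker_le_of_le {n : ℕ} {s : ℝ} (hs0 : 0 < s) (hs1 : s < 1) (x : En n) {T t : ℝ}
    (hT : 0 < T) (ht : T ≤ t) :
    Gker n s x t ≤
      ((4 * Real.pi) ^ (-(n : ℝ) / 2) / Real.Gamma s) * T ^ (-((n : ℝ) / 2 + 1 - s)) := by
  have hΓ := Real.Gamma_pos_of_pos hs0
  have ht0 : 0 < t := hT.trans_le ht
  have hn : (0 : ℝ) ≤ n := n.cast_nonneg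
  rw [Gker, if_pos ht0]
  have hpow : t ^ (-((n : ℝ) / 2 + 1 - s)) ≤ T ^ (-((n : ℝ) / 2 + 1 - s)) :=
    Real.rpow_le_rpow_of_nonpos hT ht (by linarith)
  have hexp : Real.exp (-‖x‖ ^ 2 / (4 * t)) ≤ 1 := by
    rw [Real.exp_le_one_iff, neg_div]
    exact neg_nonpos.mpr (by positivity)
  gcongr
  exact (mul_le_of_le_one_right (by positivity) hexp).trans hpow

/-- An iterated integral of a nonnegative function which is bounded by `c` and vanishes outside
`A ×ˢ B` is at most `c` times the product of the measures. -/
theorem integral_integral_le_of_support {α β : Type*} [MeasurableSpace α] [MeasurableSpace β]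
    {μ : Measure α} {ν : Measure β} {A : Set α} {B : Set β} (hA : MeasurableSet A)
    (hB : MeasurableSet B) (hAμ : μ A ≠ ⊤) (hBν : ν B ≠ ⊤) {f : β → α → ℝ} {c : ℝ}
    (hf0 : ∀ b a, 0 ≤ f b a) (hfc : ∀ b ∈ B, ∀ a ∈ A, f b a ≤ c)
    (hfA : ∀ b, ∀ a ∉ A, f b a = 0) (hfB : ∀ b ∉ B, ∀ a, f b a = 0) :
    ∫ b, ∫ a, f b a ∂μ ∂ν ≤ ν.real B * (μ.real A * c) := by
  have hinner : ∀ b ∈ B, ∫ a, f b a ∂μ ≤ μ.real A * c := fun b hb => by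
    calc ∫ a, f b a ∂μ ≤ ∫ a, A.indicator (fun _ => c) a ∂μ := by
          refine integral_mono_of_nonneg (.of_forall (hf0 b))
            ((integrable_indicator_iff hA).mpr (integrableOn_const hAμ)) (.of_forall fun a => ?_)
          by_cases ha : a ∈ A
          · simpa [ha] using hfc b hb a ha
          · simp [ha, hfA b a ha]
      _ = μ.real A * c := by simp [integral_indicator_const c hA]
  calc ∫ b, ∫ a, f b a ∂μ ∂ν ≤ ∫ b, B.indicator (fun _ => μ.real A * c) b ∂ν := by
        refine integral_mono_of_nonneg (.of_forall fun b => integral_nonneg (hf0 b))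
          ((integrable_indicator_iff hB).mpr (integrableOn_const hBν)) (.of_forall fun b => ?_)
        by_cases hb : b ∈ B
        · simpa [hb] using hinner b hb
        · simp [hb, hfB b hb]
    _ = ν.real B * (μ.real A * c) := by simp [integral_indicator_const _ hB]

/-- For a bounded compactly supported nonnegative `h`, the potential
`v(x,t) = ∫∫ G(x−y,t−τ) h(y,τ)` tends to `0` as `|t| → ∞`, uniformly in `x`. -/
theorem potential_decay_in_t (n : ℕ) (hn : 1 ≤ n)
    (s : ℝ) (hs0 : 0 < s) (hs1 : s < 1) (hns : 2 * s < n)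
    (R M : ℝ) (hR : 0 < R) (hM : 0 < M)
    (h : En n × ℝ → ℝ) (h_meas : Measurable h)
    (h_bdd : ∀ q, 0 ≤ h q ∧ h q ≤ M)
    (h_supp : ∀ (y : En n) (τ : ℝ), R < ‖y‖ ∨ R ^ 2 < |τ| → h (y, τ) = 0) :
    ∀ ε > (0 : ℝ), ∃ K > (0 : ℝ), ∀ (x : En n) (t : ℝ), K ≤ |t| →
      (∫ τ : ℝ, ∫ y : En n, Gker n s (x - y) (t - τ) * h (y, τ)) ≤ ε := by
  intro ε hε
  set a : ℝ := (4 * Real.pi) ^ (-(n : ℝ) / 2) / Real.Gamma s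
  set p : ℝ := (n : ℝ) / 2 + 1 - s with hp
  set A : Set (En n) := Metric.closedBall 0 R with hA
  set B : Set ℝ := Set.Icc (-R ^ 2) (R ^ 2) with hB
  have ha0 : 0 ≤ a := by
    have hΓ := Real.Gamma_pos_of_pos hs0
    positivity
  have hlim : Filter.Tendsto
      (fun T : ℝ => volume.real B * (volume.real A * (a * T ^ (-p) * M)))
      Filter.atTop (nhds 0) := by
    simpa using ((((tendsto_rpow_neg_atTop (y := p) (by linarith)).const_mul a).mul_const
      M).const_mul (volume.real A)).const_mul (volume.real B)
  obtain ⟨T, hTε, hT0⟩ :=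
    ((hlim.eventually_le_const hε).and (Filter.eventually_gt_atTop 0)).exists
  refine ⟨R ^ 2 + T, by positivity, fun x t ht => le_trans ?_ hTε⟩
  refine integral_integral_le_of_support Metric.isClosed_closedBall.measurableSet
    measurableSet_Icc measure_closedBall_lt_top.ne measure_Icc_lt_top.ne
    (fun τ y => mul_nonneg (Gker_nonneg hs0 _ _) (h_bdd _).1) ?_ ?_ ?_
  · intro τ hτ y _
    refine mul_le_mul ?_ (h_bdd _).2 (h_bdd _).1 (by positivity)
    rcases le_abs.mp ht with ht | ht
    · exact Gker_le_of_le hs0 hs1 _ hT0 (by linarith [hτ.2])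
    · rw [Gker, if_neg (by linarith [hτ.1])]
      positivity
  · intro τ y hy
    rw [h_supp y τ (.inl (by simpa [hA] using hy)), mul_zero]
  · intro τ hτ y
    rw [h_supp y τ (.inr (lt_of_not_ge fun hle => hτ ?_)), mul_zero]
    simpa [hB] using abs_le.mp hle
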